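/- Let T ∈ 𝒯(D) have a leaf s with |s| = l−1 for some 1 ≤ l ≤ D, and for each q ∈ 𝒜 let U_q ∈ 𝒯(D−l) be a context tree of depth at most D−l. Let T′ be the tree with leaf set ℒ(T′) = (ℒ(T) ∖ {s}) ∪ ⋃_{q∈𝒜} {uqs : u ∈ ℒ(U_q)}, i.e., T′ is obtained from T by branching the leaf s into the A children qs and grafting subtree U_q at child qs. Then T′ ∈ 𝒯(D) and π_D(T′) = π_D(T) · (1−λ) · (Π_{q∈𝒜} π_{D−l}(U_q)) / λ. -/

import Mathlib

open scoped Classical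

noncomputable section

variable {𝒜 : Type*}

/-- The finset of all strings over `𝒜` of length at most `D`. -/
def stringsLe (𝒜 : Type*) [Fintype 𝒜] (D : ℕ) : Finset (List 𝒜) :=
  Set.Finite.toFinset (List.finite_length_le 𝒜 D)

/-- A context tree of maximum depth `D`, identified with its leaf set: every leaf has length
at most `D`, no leaf is a (proper) suffix of another, and every string of length `D` has
exactly one suffix among the leaves. -/
def IsContextTree (D : ℕ) (T : Finset (List 𝒜)) : Prop :=
  (∀ s ∈ T, s.length ≤ D) ∧
  (∀ s ∈ T, ∀ t ∈ T, s <:+ t → s = t) ∧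
  (∀ w : List 𝒜, w.length = D → ∃! s, s ∈ T ∧ s <:+ w)

/-- The finset of all context trees of maximum depth `D`. -/
def contextTrees (𝒜 : Type*) [Fintype 𝒜] (D : ℕ) : Finset (Finset (List 𝒜)) :=
  (stringsLe 𝒜 D).powerset.filter (IsContextTree D)

/-- The branching-process prior `π_D` on context trees. -/
def priorD [Fintype 𝒜] (lam : ℝ) (D : ℕ) (T : Finset (List 𝒜)) : ℝ :=
  (1 - lam) ^ ((T.card - 1) / (Fintype.card 𝒜 - 1)) *
    lam ^ (T.card - (T.filter (fun s => s.length = D)).card)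

/-- The window `(x_{1-D}, …, x_{j-1})`. -/
def window (x : ℤ → 𝒜) (D : ℕ) (j : ℕ) : List 𝒜 :=
  (List.range (D + j - 1)).map (fun i => x (1 - (D : ℤ) + (i : ℤ)))

/-- The counting vector `𝐧_{n,s}(a)`. -/
def cnt [DecidableEq 𝒜] (x : ℤ → 𝒜) (D n : ℕ) (s : List 𝒜) (a : 𝒜) : ℕ :=
  ((Finset.Icc 1 n).filter (fun (j : ℕ) => x (j : ℤ) = a ∧ s <:+ window x D j)).card

/-- The evidence value `P^e(m)` of a counting vector `m` under Dirichlet parameters `α`. -/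
def pEv [Fintype 𝒜] (α : 𝒜 → ℝ) (m : 𝒜 → ℕ) : ℝ :=
  (Real.Gamma (∑ a, α a) / Real.Gamma (∑ a, ((m a : ℝ) + α a))) *
    ∏ a, (Real.Gamma ((m a : ℝ) + α a) / Real.Gamma (α a))

/-- The evidence `p^e_{n,s}`. -/
def pE [Fintype 𝒜] [DecidableEq 𝒜] (α : 𝒜 → ℝ) (x : ℤ → 𝒜) (D n : ℕ) (s : List 𝒜) : ℝ :=
  pEv α (cnt x D n s)

/-- Auxiliary downward recursion for the CTW weighted probabilities, with fuel `k = D - |s|`. -/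
def pWaux [Fintype 𝒜] [DecidableEq 𝒜] (α : 𝒜 → ℝ) (lam : ℝ) (x : ℤ → 𝒜) (D n : ℕ) :
    ℕ → List 𝒜 → ℝ
  | 0, s => pE α x D n s
  | k + 1, s => lam * pE α x D n s + (1 - lam) * ∏ q, pWaux α lam x D n k (q :: s)

/-- The CTW weighted probability `p^w_{n,s}`. -/
def pW [Fintype 𝒜] [DecidableEq 𝒜] (α : 𝒜 → ℝ) (lam : ℝ) (x : ℤ → 𝒜) (D n : ℕ)
    (s : List 𝒜) : ℝ :=
  pWaux α lam x D n (D - s.length) s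

/-- The observed suffix `s_{n,l} = (x_{n-l+1}, …, x_n)` of length `l`. -/
def sfx (x : ℤ → 𝒜) (n : ℤ) (l : ℕ) : List 𝒜 :=
  (List.range l).map (fun i => x (n - (l : ℤ) + 1 + (i : ℤ)))

/-- The CTW mixture weight `ω_{n,l}`. -/
def omegaW [Fintype 𝒜] [DecidableEq 𝒜] (α : 𝒜 → ℝ) (lam : ℝ) (x : ℤ → 𝒜) (D n l : ℕ) : ℝ :=
  (∑ T ∈ (contextTrees 𝒜 D).filter (fun T => sfx x n l ∈ T),
      priorD lam D T * ∏ s ∈ T, pE α x D n s) / pW α lam x D n []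

/-- The per-suffix Bayesian predictor `p̄_{n,s}(a)`. -/
def pBar [Fintype 𝒜] [DecidableEq 𝒜] (α : 𝒜 → ℝ) (x : ℤ → 𝒜) (D n : ℕ) (s : List 𝒜)
    (a : 𝒜) : ℝ :=
  (α a + cnt x D n s a) / ∑ q, (α q + cnt x D n s q)

end

open Finset in
/-- Kraft's equality for context trees. -/
theorem IsContextTree.sum_pow_eq {𝒜 : Type*} [Fintype 𝒜] [DecidableEq 𝒜] {D : ℕ}
    {T : Finset (List 𝒜)} (hT : IsContextTree D T) :
    ∑ s ∈ T, Fintype.card 𝒜 ^ (D - s.length) = Fintype.card 𝒜 ^ D := by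
  obtain ⟨hlen, -, hex⟩ := hT
  let words : ℕ → Finset (List 𝒜) := fun n =>
    (univ : Finset (List.Vector 𝒜 n)).image List.Vector.toList
  have mem_words (n : ℕ) (w : List 𝒜) : w ∈ words n ↔ w.length = n := by
    simp only [words, mem_image, mem_univ, true_and]
    exact ⟨fun ⟨v, hv⟩ => hv ▸ v.toList_length, fun h => ⟨⟨w, h⟩, rfl⟩⟩
  have card_words (n : ℕ) : (words n).card = Fintype.card 𝒜 ^ n := by
    rw [card_image_of_injective _ List.Vector.toList_injective, card_univ, card_vector]
  have hcover : words D = T.biUnion fun s => (words (D - s.length)).image (· ++ s) := by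
    ext w
    simp only [mem_biUnion, mem_image, mem_words]
    constructor
    · intro hw
      obtain ⟨s, ⟨hs, v, rfl⟩, -⟩ := hex w hw
      refine ⟨s, hs, v, ?_, rfl⟩
      simp only [List.length_append] at hw
      omega
    · rintro ⟨s, hs, v, hv, rfl⟩
      have := hlen s hs
      simp only [List.length_append]
      omega
  rw [← card_words D, hcover, card_biUnion]
  · refine sum_congr rfl fun s _ => ?_
    rw [card_image_of_injective _ (List.append_left_injective s), card_words]
  · intro s hs t ht hst
    refine disjoint_left.2 fun w hws hwt => hst ?_
    simp only [mem_image, mem_words] at hws hwt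
    obtain ⟨v, hv, rfl⟩ := hws
    obtain ⟨v', -, hvw⟩ := hwt
    have := hlen s hs
    exact (hex (v ++ s) (by rw [List.length_append]; omega)).unique
      ⟨hs, List.suffix_append _ _⟩ ⟨ht, v', hvw⟩

/-- A context tree has `1 + (A - 1) * k` leaves, where `k` is the number of internal nodes. -/
theorem IsContextTree.exists_card_eq {𝒜 : Type*} [Fintype 𝒜] [DecidableEq 𝒜]
    (hA : 2 ≤ Fintype.card 𝒜) {D : ℕ} {T : Finset (List 𝒜)} (hT : IsContextTree D T) :
    ∃ k, T.card = 1 + (Fintype.card 𝒜 - 1) * k := by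
  have hmod : Fintype.card 𝒜 ≡ 1 [MOD Fintype.card 𝒜 - 1] :=
    ((Nat.modEq_iff_dvd' (by omega)).2 dvd_rfl).symm
  have hsum : ∑ s ∈ T, Fintype.card 𝒜 ^ (D - s.length) ≡ T.card [MOD Fintype.card 𝒜 - 1] := by
    rw [Finset.card_eq_sum_ones]
    exact Nat.ModEq.sum fun s _ => by simpa using hmod.pow (D - s.length)
  have hcard : 1 ≡ T.card [MOD Fintype.card 𝒜 - 1] := by
    rw [hT.sum_pow_eq] at hsum
    exact (by simpa using hmod.pow D : Fintype.card 𝒜 ^ D ≡ 1 [MOD _]).symm.trans hsum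
  have : Nonempty 𝒜 := Fintype.card_pos_iff.1 (by omega)
  obtain ⟨s, ⟨hs, -⟩, -⟩ := hT.2.2 (List.replicate D (Classical.arbitrary 𝒜)) (by simp)
  have hpos : 1 ≤ T.card := Finset.card_pos.2 ⟨s, hs⟩
  obtain ⟨k, hk⟩ := (Nat.modEq_iff_dvd' hpos).1 hcard
  exact ⟨k, by omega⟩

theorem mem_contextTrees {𝒜 : Type*} [Fintype 𝒜] {D : ℕ} {T : Finset (List 𝒜)} :
    T ∈ contextTrees 𝒜 D ↔ IsContextTree D T := by
  simp only [contextTrees, stringsLe, Finset.mem_filter, Finset.mem_powerset, and_iff_right_iff_imp]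
  intro h s hs
  simpa using h.1 s hs

/-- The prior in terms of the number `k` of internal nodes and the leaves of non-maximal length. -/
theorem priorD_eq {𝒜 : Type*} [Fintype 𝒜] (hA : 2 ≤ Fintype.card 𝒜) (lam : ℝ) (D : ℕ)
    {T : Finset (List 𝒜)} {k : ℕ} (hk : T.card = 1 + (Fintype.card 𝒜 - 1) * k) :
    priorD lam D T = (1 - lam) ^ k * lam ^ (T.filter (fun s => ¬ s.length = D)).card := by
  have hsplit := T.card_filter_add_card_filter_not (fun s => s.length = D)
  rw [priorD, show T.card - 1 = (Fintype.card 𝒜 - 1) * k by omega,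
    Nat.mul_div_cancel_left _ (by omega),
    show T.card - (T.filter (fun s => s.length = D)).card
      = (T.filter (fun s => ¬ s.length = D)).card by omega]

/-- Branching `s` and grafting `U q` at each child `q :: s` yields a context tree. -/
theorem IsContextTree.graft {𝒜 : Type*} [Fintype 𝒜] [DecidableEq 𝒜] {D l : ℕ} (hl : 1 ≤ l)
    (hlD : l ≤ D) {T : Finset (List 𝒜)} (hT : IsContextTree D T) {s : List 𝒜} (hs : s ∈ T)
    (hslen : s.length = l - 1) {U : 𝒜 → Finset (List 𝒜)}
    (hU : ∀ q, IsContextTree (D - l) (U q)) :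
    IsContextTree D
      (T.erase s ∪ Finset.univ.biUnion (fun q => (U q).image (fun u => u ++ q :: s))) := by
  have hsuffix (u : List 𝒜) (q : 𝒜) : s <:+ u ++ q :: s := ⟨u ++ [q], by simp⟩
  have hfree : ∀ a ∈ T.erase s ∪ Finset.univ.biUnion (fun q => (U q).image (fun u => u ++ q :: s)),
      ∀ b ∈ T.erase s ∪ Finset.univ.biUnion (fun q => (U q).image (fun u => u ++ q :: s)),
      a <:+ b → a = b := by
    simp only [Finset.mem_union, Finset.mem_erase, Finset.mem_biUnion, Finset.mem_univ, true_and,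
      Finset.mem_image]
    rintro a (⟨has, ha⟩ | ⟨q, u, hu, rfl⟩) b (⟨hbs, hb⟩ | ⟨q', u', hu', rfl⟩) hab
    · exact hT.2.1 a ha b hb hab
    · rcases List.suffix_or_suffix_of_suffix hab (hsuffix u' q') with h | h
      · exact absurd (hT.2.1 a ha s hs h) has
      · exact absurd (hT.2.1 s hs a ha h).symm has
    · exact absurd (hT.2.1 s hs b hb ((hsuffix u q).trans hab)).symm hbs
    · obtain ⟨v, hv⟩ := hab
      have hv' : ((v ++ u) ++ [q]) ++ s = (u' ++ [q']) ++ s := by simpa using hv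
      obtain ⟨huv, hq⟩ := List.append_inj' (List.append_cancel_right hv') rfl
      obtain rfl : q = q' := by simpa using hq
      rw [(hU q).2.1 u hu u' hu' ⟨v, huv⟩]
  refine ⟨?_, hfree, fun w hw => ?_⟩
  · simp only [Finset.mem_union, Finset.mem_erase, Finset.mem_biUnion, Finset.mem_univ, true_and,
      Finset.mem_image]
    rintro a (⟨-, ha⟩ | ⟨q, u, hu, rfl⟩)
    · exact hT.1 a ha
    · have := (hU q).1 u hu
      simp only [List.length_append, List.length_cons]
      omega
  · refine existsUnique_of_exists_of_unique ?_ ?_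
    · obtain ⟨t, ⟨ht, htw⟩, -⟩ := hT.2.2 w hw
      by_cases hts : t = s
      · subst hts
        obtain ⟨v, rfl⟩ := htw
        rw [List.length_append] at hw
        obtain rfl | ⟨v', q, rfl⟩ := v.eq_nil_or_concat'
        · simp only [List.length_nil] at hw
          omega
        simp only [List.length_append, List.length_cons, List.length_nil] at hw
        obtain ⟨u, ⟨hu, x, rfl⟩, -⟩ := (hU q).2.2 v' (by omega)
        refine ⟨u ++ q :: t, ?_, x, by simp⟩
        exact Finset.mem_union_right _ (Finset.mem_biUnion.2
          ⟨q, Finset.mem_univ _, Finset.mem_image_of_mem _ hu⟩)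
      · exact ⟨t, Finset.mem_union_left _ (Finset.mem_erase.2 ⟨hts, ht⟩), htw⟩
    · rintro a b ⟨ha, haw⟩ ⟨hb, hbw⟩
      rcases List.suffix_or_suffix_of_suffix haw hbw with h | h
      · exact hfree a ha b hb h
      · exact (hfree b hb a ha h).symm

/-- A sum over the leaves of a grafted tree splits over `T.erase s` and the grafted subtrees. -/
theorem IsContextTree.sum_graft {𝒜 : Type*} [Fintype 𝒜] [DecidableEq 𝒜] {D : ℕ}
    {T : Finset (List 𝒜)} (hT : IsContextTree D T) {s : List 𝒜} (hs : s ∈ T)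
    (U : 𝒜 → Finset (List 𝒜)) (f : List 𝒜 → ℕ) :
    ∑ t ∈ T.erase s ∪ Finset.univ.biUnion (fun q => (U q).image (fun u => u ++ q :: s)), f t
      = ∑ t ∈ T.erase s, f t + ∑ q, ∑ u ∈ U q, f (u ++ q :: s) := by
  rw [Finset.sum_union, Finset.sum_biUnion]
  · congr 1
    exact Finset.sum_congr rfl fun q _ =>
      Finset.sum_image fun u _ v _ h => List.append_cancel_right h
  · intro q _ q' _ hqq'
    refine Finset.disjoint_left.2 fun w hw hw' => hqq' ?_
    obtain ⟨u, -, rfl⟩ := Finset.mem_image.1 hw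
    obtain ⟨u', -, h⟩ := Finset.mem_image.1 hw'
    exact (List.cons_eq_cons.1 (List.append_inj' h (by simp)).2).1.symm
  · refine Finset.disjoint_left.2 fun w hw hw' => ?_
    obtain ⟨q, -, hq⟩ := Finset.mem_biUnion.1 hw'
    obtain ⟨u, -, rfl⟩ := Finset.mem_image.1 hq
    obtain ⟨hne, hmem⟩ := Finset.mem_erase.1 hw
    exact hne (hT.2.1 s hs _ hmem ⟨u ++ [q], by simp⟩).symm

/-- Grafting: branching a leaf `s` of length `l - 1` of a context tree `T` into
its `A` children and grafting a context tree `U q` of depth at most `D - l` at each child `q :: s`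
yields a context tree `T'` of depth at most `D`, whose prior satisfies
`π_D(T') = π_D(T) · (1 - λ) · (Π_q π_{D-l}(U q)) / λ`. -/
theorem prior_graft_formula {𝒜 : Type*} [Fintype 𝒜] [DecidableEq 𝒜]
    (hA : 2 ≤ Fintype.card 𝒜) (D : ℕ) (hD : 1 ≤ D)
    (lam : ℝ) (hlam : lam ∈ Set.Ioo (0 : ℝ) 1)
    (l : ℕ) (hl : 1 ≤ l) (hlD : l ≤ D)
    (T : Finset (List 𝒜)) (hT : T ∈ contextTrees 𝒜 D)
    (s : List 𝒜) (hs : s ∈ T) (hslen : s.length = l - 1)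
    (U : 𝒜 → Finset (List 𝒜)) (hU : ∀ q, U q ∈ contextTrees 𝒜 (D - l)) :
    T.erase s ∪ Finset.univ.biUnion (fun q => (U q).image (fun u => u ++ q :: s))
        ∈ contextTrees 𝒜 D ∧
    priorD lam D
        (T.erase s ∪ Finset.univ.biUnion (fun q => (U q).image (fun u => u ++ q :: s)))
      = priorD lam D T * (1 - lam) * (∏ q, priorD lam (D - l) (U q)) / lam := by
  rw [mem_contextTrees] at hT
  simp only [mem_contextTrees] at hU ⊢
  refine ⟨hT.graft hl hlD hs hslen hU, ?_⟩
  obtain ⟨k, hk⟩ := hT.exists_card_eq hA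
  choose m hm using fun q => (hU q).exists_card_eq hA
  have hcard : (T.erase s ∪
      Finset.univ.biUnion (fun q => (U q).image (fun u => u ++ q :: s))).card
      = 1 + (Fintype.card 𝒜 - 1) * (k + 1 + ∑ q, m q) := by
    rw [Finset.card_eq_sum_ones, hT.sum_graft hs]
    simp only [← Finset.card_eq_sum_ones, Finset.card_erase_of_mem hs, hk, hm,
      Finset.sum_add_distrib, ← Finset.mul_sum, Finset.card_univ]
    rw [mul_add, mul_add]
    omega
  have hlow : ((T.erase s ∪
      Finset.univ.biUnion (fun q => (U q).image (fun u => u ++ q :: s))).filter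
        (fun t => ¬ t.length = D)).card + 1
      = (T.filter (fun t => ¬ t.length = D)).card
        + ∑ q, ((U q).filter (fun u => ¬ u.length = D - l)).card := by
    have hlen (u : List 𝒜) (q : 𝒜) : (u ++ q :: s).length = D ↔ u.length = D - l := by
      simp only [List.length_append, List.length_cons]
      omega
    simp only [Finset.card_filter]
    rw [hT.sum_graft hs, ← Finset.sum_erase_add T _ hs]
    simp only [hlen]
    rw [if_pos (show ¬ s.length = D by omega)]
    omega
  rw [priorD_eq hA lam D hcard, priorD_eq hA lam D hk, eq_div_iff hlam.1.ne', mul_assoc,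
    ← pow_succ, hlow]
  simp only [fun q => priorD_eq hA lam (D - l) (hm q), Finset.prod_mul_distrib,
    Finset.prod_pow_eq_pow_sum]
  ring
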